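/- Let B be a reduced commutative von Neumann regular ring such that for every prime ideal p of B the residue ring B/p is a real closed field, and let A be a subring of B that is integrally closed in B. Then every monic polynomial of odd degree in A[X] has a root in A. -/

import Mathlib

/-- A commutative ring `K` is a real closed field if it is a field, `−1` is not a sum
of squares, every element or its negative is a square, and every polynomial of odd
degree has a root. -/
def IsRealClosedField (K : Type*) [CommRing K] : Prop :=
  IsField K ∧
    (∀ (n : ℕ) (f : Fin n → K), (-1 : K) ≠ ∑ i, f i ^ 2) ∧
    (∀ x : K, (∃ y : K, x = y ^ 2) ∨ ∃ y : K, -x = y ^ 2) ∧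
    ∀ f : Polynomial K, Odd f.natDegree → ∃ x : K, f.eval x = 0

/-- If `e` annihilates `d - b`, then `e * f(d) = e * f(b)`. -/
theorem Polynomial.mul_eval_eq_of_mul_sub_eq_zero {B : Type*} [CommRing B] (f : Polynomial B)
    {e d b : B} (h : e * (d - b) = 0) : e * f.eval d = e * f.eval b := by
  obtain ⟨q, hq⟩ := Polynomial.sub_dvd_eval_sub d b f
  linear_combination e * hq + q * h

/-- Over a von Neumann regular ring, the elements `x` such that `x * f(b) = 0` for some `b`
form an ideal. -/
def Polynomial.annihilatedEvalIdeal {B : Type*} [CommRing B]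
    (hvnr : ∀ x : B, ∃ y : B, x = x ^ 2 * y) (f : Polynomial B) : Ideal B where
  carrier := {x | ∃ b, x * f.eval b = 0}
  zero_mem' := ⟨0, zero_mul _⟩
  smul_mem' := by
    rintro c x ⟨b, hb⟩
    exact ⟨b, by rw [smul_eq_mul, mul_assoc, hb, mul_zero]⟩
  add_mem' := by
    rintro x y ⟨b, hb⟩ ⟨c, hc⟩
    obtain ⟨z, hz⟩ := hvnr x
    refine ⟨x * z * b + (1 - x * z) * c, ?_⟩
    have h₁ := f.mul_eval_eq_of_mul_sub_eq_zero (e := x)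
      (d := x * z * b + (1 - x * z) * c) (b := b) (by linear_combination (c - b) * hz)
    have h₂ := f.mul_eval_eq_of_mul_sub_eq_zero (e := 1 - x * z)
      (d := x * z * b + (1 - x * z) * c) (b := c)
      (by linear_combination z * (b - c) * hz)
    linear_combination (1 + y * z) * h₁ + (1 + y * z) * hb + y * h₂ + (1 - x * z) * hc

/-- A polynomial over a von Neumann regular ring that has a root modulo every maximal ideal
has a root. -/
theorem Polynomial.exists_eval_eq_zero_of_forall_isMaximal {B : Type*} [CommRing B]
    (hvnr : ∀ x : B, ∃ y : B, x = x ^ 2 * y) (f : Polynomial B)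
    (h : ∀ p : Ideal B, p.IsMaximal → ∃ b, f.eval b ∈ p) : ∃ b, f.eval b = 0 := by
  have htop : f.annihilatedEvalIdeal hvnr = ⊤ := by
    by_contra hne
    obtain ⟨p, hp, hle⟩ := Ideal.exists_le_maximal _ hne
    obtain ⟨b, hb⟩ := h p hp
    obtain ⟨z, hz⟩ := hvnr (f.eval b)
    have hmem : 1 - f.eval b * z ∈ p := hle ⟨b, by linear_combination hz⟩
    refine hp.ne_top ((Ideal.eq_top_iff_one p).2 ?_)
    simpa using p.add_mem hmem (p.mul_mem_right z hb)
  obtain ⟨b, hb⟩ := (Ideal.eq_top_iff_one _).1 htop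
  exact ⟨b, by simpa using hb⟩

/-- Let `B` be a reduced commutative von Neumann regular ring all of whose residue
rings at prime ideals are real closed fields, and let `A` be a subring of `B`
integrally closed in `B`.  Then every monic polynomial of odd degree with
coefficients in `A` has a root in `A`. -/
theorem monic_odd_degree_root_of_integrallyClosed {B : Type*} [CommRing B] [IsReduced B]
    (hvnr : ∀ x : B, ∃ y : B, x = x ^ 2 * y)
    (hrc : ∀ p : Ideal B, p.IsPrime → IsRealClosedField (B ⧸ p))
    (A : Subring B)
    (hic : ∀ b : B,
      (∃ f : Polynomial B, f.Monic ∧ (∀ i, f.coeff i ∈ A) ∧ f.eval b = 0) → b ∈ A)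
    (f : Polynomial B) (hf : f.Monic) (hodd : Odd f.natDegree)
    (hcoeff : ∀ i, f.coeff i ∈ A) :
    ∃ a ∈ A, f.eval a = 0 := by
  obtain ⟨b, hb⟩ := f.exists_eval_eq_zero_of_forall_isMaximal hvnr fun p hp ↦ by
    have : Nontrivial (B ⧸ p) := Ideal.Quotient.nontrivial_iff.2 hp.ne_top
    obtain ⟨x, hx⟩ := (hrc p hp.isPrime).2.2.2 (f.map (Ideal.Quotient.mk p))
      (by rwa [hf.natDegree_map])
    obtain ⟨b, rfl⟩ := Ideal.Quotient.mk_surjective x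
    rw [Polynomial.eval_map_apply] at hx
    exact ⟨b, Ideal.Quotient.eq_zero_iff_mem.1 hx⟩
  exact ⟨b, hic b ⟨f, hf, hcoeff, hb⟩, hb⟩
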